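/- arXiv:2604.26532 — 3 statements merged into one kernel-verified Lean document; each statement's English description precedes it below -/
import Mathlib

section
/- Let N_T, K, N, N_RF be positive integers and P_T > 0 a real number. The following are equivalent: (i) N_RF ≥ min{N_T, K·N}; (ii) for every matrix W ∈ ℂ^{N_T × KN} with ‖W‖_F² ≤ P_T there exist matrices P ∈ ℂ^{N_T × N_RF} with spectral norm ‖P‖₂ ≤ 1 and W̃ ∈ ℂ^{N_RF × KN} with ‖W̃‖_F² ≤ P_T such that W = P·W̃. (Proposition 1: hybrid digital-MiLAC beamforming can realize any set of fully-digital beamforming matrices across N subcarriers if and only if the number of RF chains satisfies N_RF ≥ min{N_T, KN}.) -/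
/-- Spectral norm of a complex matrix: the operator norm induced by the
Euclidean vector norm (i.e. the largest singular value). -/
noncomputable def specNorm {m n : ℕ} (A : Matrix (Fin m) (Fin n) ℂ) : ℝ :=
  ‖LinearMap.toContinuousLinearMap (Matrix.toEuclideanLin A)‖

/-- Squared Frobenius norm of a complex matrix: the sum of squared absolute
values of its entries. -/
noncomputable def frobSq {m n : ℕ} (A : Matrix (Fin m) (Fin n) ℂ) : ℝ :=
  ∑ i, ∑ j, ‖A i j‖ ^ 2

/-- A finite-dimensional inner product space embeds isometrically in `ℂ^n` once `n` is at least
its dimension. -/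
theorem exists_linearIsometry_euclideanSpace {E : Type*} [NormedAddCommGroup E]
    [InnerProductSpace ℂ E] [FiniteDimensional ℂ E] {n : ℕ} (h : Module.finrank ℂ E ≤ n) :
    Nonempty (E →ₗᵢ[ℂ] EuclideanSpace ℂ (Fin n)) := by
  let b := stdOrthonormalBasis ℂ E
  let e := EuclideanSpace.basisFun (Fin n) ℂ
  let f : E →ₗ[ℂ] EuclideanSpace ℂ (Fin n) :=
    b.toBasis.constr ℂ fun i => e (Fin.castLE h i)
  have hf : f ∘ b.toBasis = fun i => e (Fin.castLE h i) :=
    funext fun i => b.toBasis.constr_basis ℂ _ i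
  refine ⟨f.isometryOfOrthonormal (v := b.toBasis) (by simp) ?_⟩
  rw [hf]
  exact e.orthonormal.comp _ (Fin.castLE_injective h)

/-- The squared Frobenius norm is the sum of the squared Euclidean norms of the columns. -/
theorem frobSq_eq_sum_norm_toEuclideanLin {m n : ℕ} (A : Matrix (Fin m) (Fin n) ℂ) :
    frobSq A = ∑ j, ‖Matrix.toEuclideanLin A (EuclideanSpace.single j 1)‖ ^ 2 := by
  rw [frobSq, Finset.sum_comm]
  refine Finset.sum_congr rfl fun j _ => ?_
  rw [EuclideanSpace.norm_sq_eq]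
  simp [Matrix.toLpLin_apply]

/-- A matrix of rank at most `r` factors as a contraction with `r` columns times a matrix with the
same Frobenius norm. -/
theorem exists_contraction_factorization {m n r : ℕ} (W : Matrix (Fin m) (Fin n) ℂ)
    (h : W.rank ≤ r) :
    ∃ (P : Matrix (Fin m) (Fin r) ℂ) (V : Matrix (Fin r) (Fin n) ℂ),
      specNorm P ≤ 1 ∧ frobSq V = frobSq W ∧ W = P * V := by
  let w := Matrix.toEuclideanLin W
  have hw : Module.finrank ℂ (LinearMap.range w) = W.rank := by
    rw [W.rank_eq_finrank_range_toLin (EuclideanSpace.basisFun _ ℂ).toBasis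
      (EuclideanSpace.basisFun _ ℂ).toBasis, ← Matrix.toEuclideanLin_eq_toLin_orthonormal]
  obtain ⟨T⟩ := exists_linearIsometry_euclideanSpace (E := LinearMap.range w) (hw.trans_le h)
  let p : EuclideanSpace ℂ (Fin r) →L[ℂ] EuclideanSpace ℂ (Fin m) :=
    (LinearMap.range w).subtypeL ∘L ContinuousLinearMap.adjoint T.toContinuousLinearMap
  let v : EuclideanSpace ℂ (Fin n) →ₗ[ℂ] EuclideanSpace ℂ (Fin r) :=
    T.toLinearMap ∘ₗ w.rangeRestrict
  refine ⟨Matrix.toEuclideanLin.symm p.toLinearMap, Matrix.toEuclideanLin.symm v, ?_, ?_, ?_⟩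
  · have hp : ‖p‖ ≤ 1 := by
      refine (ContinuousLinearMap.opNorm_comp_le _ _).trans
        (mul_le_one₀ (Submodule.norm_subtypeL_le _) (ContinuousLinearMap.opNorm_nonneg _) ?_)
      rw [LinearIsometryEquiv.norm_map]
      exact T.norm_toContinuousLinearMap_le
    rw [specNorm, LinearEquiv.apply_symm_apply]
    exact hp
  · simp only [frobSq_eq_sum_norm_toEuclideanLin, LinearEquiv.apply_symm_apply]
    refine Finset.sum_congr rfl fun j _ => ?_
    congr 1
    exact T.norm_map _
  · apply Matrix.toEuclideanLin.injective
    rw [Matrix.toLpLin_mul_same, LinearEquiv.apply_symm_apply, LinearEquiv.apply_symm_apply]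
    ext1 x
    have hT : ContinuousLinearMap.adjoint T.toContinuousLinearMap (T (w.rangeRestrict x)) =
        w.rangeRestrict x := by
      refine ext_inner_right ℂ fun y => ?_
      rw [ContinuousLinearMap.adjoint_inner_left]
      exact T.inner_map_map _ _
    exact (congrArg Subtype.val hT).symm

/-- If every matrix in a Frobenius ball of positive radius factors through `ℂ^r`, then `r` is at
least the smaller of the two dimensions. -/
theorem min_le_of_forall_exists_factorization {m n r : ℕ} {c : ℝ} (hc : 0 < c)
    (h : ∀ W : Matrix (Fin m) (Fin n) ℂ, frobSq W ≤ c →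
      ∃ (P : Matrix (Fin m) (Fin r) ℂ) (V : Matrix (Fin r) (Fin n) ℂ), W = P * V) :
    min m n ≤ r := by
  let t : ℝ := √(c / (m * n + 1))
  have ht : 0 < t := by positivity
  let W : Matrix (Fin m) (Fin n) ℂ := .of fun i j => if (i : ℕ) = j then (t : ℂ) else 0
  have hW : frobSq W ≤ c := by
    have hentry : ∀ i j, ‖W i j‖ ^ 2 ≤ c / (m * n + 1) := by
      intro i j
      simp only [W, Matrix.of_apply]
      split_ifs
      · rw [Complex.norm_real, Real.norm_of_nonneg ht.le, Real.sq_sqrt (by positivity)]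
      · simp only [norm_zero, ne_eq, OfNat.ofNat_ne_zero, not_false_eq_true, zero_pow]
        positivity
    calc frobSq W ≤ ∑ _i : Fin m, ∑ _j : Fin n, c / (m * n + 1) :=
          Finset.sum_le_sum fun i _ => Finset.sum_le_sum fun j _ => hentry i j
      _ = (m * n) * c / (m * n + 1) := by simp; ring
      _ ≤ c := by rw [div_le_iff₀ (by positivity)]; linarith
  obtain ⟨P, V, hPV⟩ := h W hW
  let f : Fin (min m n) → Fin m := Fin.castLE (min_le_left _ _)
  let g : Fin (min m n) → Fin n := Fin.castLE (min_le_right _ _)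
  have hsub : W.submatrix f g = (t : ℂ) • 1 := by
    ext i j
    simp [W, f, g, Matrix.one_apply, Fin.ext_iff]
  have hunit : IsUnit (W.submatrix f g) := by
    rw [Matrix.isUnit_iff_isUnit_det, hsub]
    simp [ht.ne']
  have hmul : W.submatrix f g = P.submatrix f id * V.submatrix id g := by
    rw [hPV, Matrix.submatrix_mul _ _ f id g Function.bijective_id]
  calc min m n = (W.submatrix f g).rank := by rw [Matrix.rank_of_isUnit _ hunit, Fintype.card_fin]
    _ ≤ (P.submatrix f id).rank := hmul ▸ Matrix.rank_mul_le_left _ _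
    _ ≤ r := Matrix.rank_le_width _


/-- Proposition 1: hybrid digital-MiLAC beamforming can realize any set of
fully-digital beamforming matrices across the N subcarriers if and only if
`N_RF ≥ min{N_T, K·N}`. -/
theorem prop1_iff (N_T K N N_RF : ℕ) (hNT : 0 < N_T) (hK : 0 < K) (hN : 0 < N)
    (hNRF : 0 < N_RF) (P_T : ℝ) (hPT : 0 < P_T) :
    N_RF ≥ min N_T (K * N) ↔
      ∀ W : Matrix (Fin N_T) (Fin (K * N)) ℂ, frobSq W ≤ P_T →
        ∃ (P : Matrix (Fin N_T) (Fin N_RF) ℂ) (Wt : Matrix (Fin N_RF) (Fin (K * N)) ℂ),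
          specNorm P ≤ 1 ∧ frobSq Wt ≤ P_T ∧ W = P * Wt := by
  constructor
  · intro h W hW
    have hrank : W.rank ≤ N_RF := (le_min W.rank_le_height W.rank_le_width).trans h
    obtain ⟨P, V, hP, hV, hPV⟩ := exists_contraction_factorization W hrank
    exact ⟨P, V, hP, hV.trans_le hW, hPV⟩
  · intro h
    refine min_le_of_forall_exists_factorization hPT fun W hW => ?_
    obtain ⟨P, V, -, -, hPV⟩ := h W hW
    exact ⟨P, V, hPV⟩
end

section
/- Let N_T, K, N be positive integers, P_T > 0, and N_RF ≥ min{N_T, K·N}. Then for every matrix W ∈ ℂ^{N_T × KN} with ‖W‖_F² ≤ P_T there exist P ∈ ℂ^{N_T × N_RF} with spectral norm ‖P‖₂ ≤ 1 and W̃ ∈ ℂ^{N_RF × KN} with ‖W̃‖_F² ≤ P_T such that W = P·W̃. (Sufficiency part of Proposition 1, established via the compact SVD W = UΣV^H by taking P = U and W̃ = ΣV^H, suitably zero-padded to size.) -/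
open scoped InnerProductSpace

/-- A subspace of dimension at most `n` admits a Bessel family of `n` vectors, namely a zero-padded
orthonormal basis, that reconstructs every vector of the subspace. -/
theorem exists_bessel_family {E : Type*} [NormedAddCommGroup E] [InnerProductSpace ℂ E]
    (S : Submodule ℂ E) [FiniteDimensional ℂ S] {n : ℕ} (hn : Module.finrank ℂ S ≤ n) :
    ∃ v : Fin n → E, (∀ y, ∑ j, ‖⟪v j, y⟫_ℂ‖ ^ 2 ≤ ‖y‖ ^ 2) ∧
      ∀ y ∈ S, ∑ j, ⟪v j, y⟫_ℂ • v j = y := by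
  let b := stdOrthonormalBasis ℂ S
  have hb : Orthonormal ℂ (fun i => (b i : E)) :=
    b.orthonormal.comp_linearIsometry S.subtypeₗᵢ
  have hinj := Fin.castLE_injective hn
  refine ⟨Function.extend (Fin.castLE hn) (fun i => (b i : E)) 0, fun y => ?_, fun y hy => ?_⟩
  · rw [← Fintype.sum_of_injective _ hinj (fun i => ‖⟪(b i : E), y⟫_ℂ‖ ^ 2)]
    · exact hb.sum_inner_products_le y
    · intro j hj
      simp [Function.extend_apply' _ _ _ hj]
    · intro i
      rw [hinj.extend_apply]
  · rw [← Fintype.sum_of_injective _ hinj (fun i => ⟪(b i : E), y⟫_ℂ • (b i : E))]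
    · simpa using congrArg Subtype.val (b.sum_repr' ⟨y, hy⟩)
    · intro j hj
      simp [Function.extend_apply' _ _ _ hj]
    · intro i
      rw [hinj.extend_apply]

open scoped Matrix.Norms.L2Operator in
/-- The spectral norm is invariant under conjugate transposition. -/
theorem specNorm_conjTranspose {m n : ℕ} (A : Matrix (Fin m) (Fin n) ℂ) :
    specNorm A.conjTranspose = specNorm A :=
  Matrix.l2_opNorm_conjTranspose A

/-- Sufficiency part of Proposition 1: if `N_RF ≥ min{N_T, K·N}`, every
fully-digital beamformer W with Frobenius power at most P_T can be realized as
W = P·W̃ with ‖P‖₂ ≤ 1 and ‖W̃‖_F² ≤ P_T. -/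
theorem prop1_sufficiency (N_T K N N_RF : ℕ) (hNT : 0 < N_T) (hK : 0 < K) (hN : 0 < N)
    (P_T : ℝ) (hPT : 0 < P_T) (hNRF : N_RF ≥ min N_T (K * N)) :
    ∀ W : Matrix (Fin N_T) (Fin (K * N)) ℂ, frobSq W ≤ P_T →
      ∃ (P : Matrix (Fin N_T) (Fin N_RF) ℂ) (Wt : Matrix (Fin N_RF) (Fin (K * N)) ℂ),
        specNorm P ≤ 1 ∧ frobSq Wt ≤ P_T ∧ W = P * Wt := by
  intro W hW
  let w : Fin (K * N) → EuclideanSpace ℂ (Fin N_T) := fun c => WithLp.toLp 2 (fun i => W i c)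
  have hrank : Module.finrank ℂ (Submodule.span ℂ (Set.range w)) ≤ N_RF := by
    refine le_trans (le_min ?_ ?_) hNRF
    · simpa using Submodule.finrank_le (Submodule.span ℂ (Set.range w))
    · simpa [Set.finrank] using finrank_range_le_card (R := ℂ) w
  obtain ⟨v, hbessel, hrec⟩ := exists_bessel_family _ hrank
  refine ⟨Matrix.of fun i j => v j i, Matrix.of fun j c => ⟪v j, w c⟫_ℂ, ?_, ?_, ?_⟩
  · rw [← specNorm_conjTranspose]
    refine ContinuousLinearMap.opNorm_le_bound _ zero_le_one fun y => ?_
    rw [one_mul]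
    refine le_of_pow_le_pow_left₀ two_ne_zero (norm_nonneg _) ?_
    refine le_trans (le_of_eq ?_) (hbessel y)
    rw [EuclideanSpace.norm_sq_eq]
    refine Finset.sum_congr rfl fun j _ => ?_
    simp [Matrix.toLpLin_apply, Matrix.mulVec, dotProduct, PiLp.inner_apply, mul_comm]
  · refine le_trans ?_ hW
    unfold frobSq
    rw [Finset.sum_comm, Finset.sum_comm (f := fun i j => ‖W i j‖ ^ 2)]
    refine Finset.sum_le_sum fun c _ => (hbessel (w c)).trans_eq ?_
    rw [EuclideanSpace.norm_sq_eq]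
  · ext i c
    have h := congrArg (fun x : EuclideanSpace ℂ (Fin N_T) => x i)
      (hrec (w c) (Submodule.subset_span ⟨c, rfl⟩))
    simpa [Matrix.mul_apply, w, mul_comm] using h.symm
end

section
/- Let m ≥ r be positive integers and X ∈ ℂ^{m×r}, with singular value decomposition X = U Σ V^H where U ∈ ℂ^{m×m} and V ∈ ℂ^{r×r} are unitary and Σ ∈ ℝ^{m×r} has the singular values σ₁, …, σ_r on its main diagonal and zeros elsewhere. Let Σ̃ be obtained from Σ by replacing each σ_i with min{1, σ_i}, and set X̃ = U Σ̃ V^H. Then ‖X̃‖₂ ≤ 1, and for every P ∈ ℂ^{m×r} with ‖P‖₂ ≤ 1 one has ‖X − X̃‖_F ≤ ‖X − P‖_F; that is, X̃ is a Euclidean (Frobenius-norm) projection of X onto the spectral-norm unit ball {P : ‖P‖₂ ≤ 1}. (Correctness of the singular-value-thresholding projection used in the projected gradient descent step of the WMMSE algorithm.) -/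
open Matrix

/-- Frobenius norm of a complex matrix. -/
noncomputable def frobNorm {m n : ℕ} (A : Matrix (Fin m) (Fin n) ℂ) : ℝ :=
  Real.sqrt (frobSq A)

open scoped Matrix.Norms.L2Operator in
lemma specNorm_eq_norm {m n : ℕ} (A : Matrix (Fin m) (Fin n) ℂ) : specNorm A = ‖A‖ :=
  (Matrix.l2_opNorm_def A).symm

lemma specNorm_nonneg {m n : ℕ} (A : Matrix (Fin m) (Fin n) ℂ) : 0 ≤ specNorm A :=
  norm_nonneg _

lemma specNorm_mul_le_one {l m n : ℕ} {A : Matrix (Fin l) (Fin m) ℂ}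
    {B : Matrix (Fin m) (Fin n) ℂ} (hA : specNorm A ≤ 1) (hB : specNorm B ≤ 1) :
    specNorm (A * B) ≤ 1 := by
  have hA₀ := specNorm_nonneg A
  have hB₀ := specNorm_nonneg B
  rw [specNorm_eq_norm] at *
  exact (Matrix.l2_opNorm_mul A B).trans (mul_le_one₀ hA hB₀ hB)

lemma specNorm_le_one_of_conjTranspose_mul_self_eq_diagonal {m n : ℕ}
    {A : Matrix (Fin m) (Fin n) ℂ} {v : Fin n → ℂ} (hA : Aᴴ * A = Matrix.diagonal v)
    (hv : ∀ i, ‖v i‖ ≤ 1) : specNorm A ≤ 1 := by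
  have hA₀ := specNorm_nonneg A
  rw [specNorm_eq_norm] at *
  have h := Matrix.l2_opNorm_conjTranspose_mul_self A
  rw [hA, Matrix.l2_opNorm_diagonal] at h
  have hv' : ‖v‖ ≤ 1 := (pi_norm_le_iff_of_nonneg zero_le_one).2 hv
  nlinarith

lemma specNorm_le_one_of_mem_unitaryGroup {n : ℕ} {U : Matrix (Fin n) (Fin n) ℂ}
    (hU : U ∈ Matrix.unitaryGroup (Fin n) ℂ) : specNorm U ≤ 1 :=
  specNorm_le_one_of_conjTranspose_mul_self_eq_diagonal (v := fun _ => 1)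
    ((Matrix.mem_unitaryGroup_iff'.1 hU).trans Matrix.diagonal_one.symm) (by simp)

lemma conjTranspose_mem_unitaryGroup {n : ℕ} {U : Matrix (Fin n) (Fin n) ℂ}
    (hU : U ∈ Matrix.unitaryGroup (Fin n) ℂ) : Uᴴ ∈ Matrix.unitaryGroup (Fin n) ℂ :=
  Unitary.star_mem hU

lemma norm_entry_le_specNorm {m n : ℕ} (A : Matrix (Fin m) (Fin n) ℂ) (i : Fin m) (j : Fin n) :
    ‖A i j‖ ≤ specNorm A := by
  have h := Matrix.l2_opNorm_mulVec A (EuclideanSpace.single j 1)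
  rw [← specNorm_eq_norm, PiLp.norm_single, norm_one, mul_one] at h
  refine le_trans ?_ ((PiLp.norm_apply_le _ i).trans h)
  simp

/-- A rectangular diagonal matrix with at least as many rows as columns is a contraction as soon
as its diagonal entries have modulus at most one. -/
lemma specNorm_rectDiagonal_le_one {m r : ℕ} (hmr : r ≤ m) {d : Fin r → ℂ}
    (hd : ∀ j, ‖d j‖ ≤ 1) :
    specNorm (Matrix.of fun (i : Fin m) (j : Fin r) => if (i : ℕ) = (j : ℕ) then d j else 0)
      ≤ 1 := by
  refine specNorm_le_one_of_conjTranspose_mul_self_eq_diagonal (v := fun j => star (d j) * d j)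
    ?_ fun j => ?_
  · ext j k
    rw [Matrix.mul_apply, Finset.sum_eq_single (Fin.castLE hmr j)]
    · by_cases h : j = k
      · subst h; simp
      · simp [h, Fin.val_inj]
    · intro i _ hi
      have : (i : ℕ) ≠ j := fun h => hi (Fin.ext h)
      simp [this]
    · simp
  · rw [norm_mul, norm_star]
    exact mul_le_one₀ (hd j) (norm_nonneg _) (hd j)

lemma frobSq_eq_trace {m n : ℕ} (A : Matrix (Fin m) (Fin n) ℂ) :
    (frobSq A : ℂ) = (Aᴴ * A).trace := by
  simp only [frobSq, Matrix.trace, Matrix.diag, Matrix.mul_apply, Matrix.conjTranspose_apply]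
  rw [Finset.sum_comm]
  push_cast
  refine Finset.sum_congr rfl fun i _ => Finset.sum_congr rfl fun j _ => ?_
  exact (RCLike.conj_mul (A j i)).symm

lemma frobNorm_unitary_mul_mul_unitary {m n : ℕ} {U : Matrix (Fin m) (Fin m) ℂ}
    {W : Matrix (Fin n) (Fin n) ℂ} (hU : U ∈ Matrix.unitaryGroup (Fin m) ℂ)
    (hW : W ∈ Matrix.unitaryGroup (Fin n) ℂ) (A : Matrix (Fin m) (Fin n) ℂ) :
    frobNorm (U * A * W) = frobNorm A := by
  have hU' : Uᴴ * U = 1 := Matrix.mem_unitaryGroup_iff'.1 hU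
  have hW' : W * Wᴴ = 1 := Matrix.mem_unitaryGroup_iff.1 hW
  unfold frobNorm
  congr 1
  apply Complex.ofReal_injective
  rw [frobSq_eq_trace, frobSq_eq_trace]
  calc ((U * A * W)ᴴ * (U * A * W)).trace = (Wᴴ * (Aᴴ * (Uᴴ * U) * A * W)).trace := by
        simp only [Matrix.conjTranspose_mul, Matrix.mul_assoc]
    _ = (Aᴴ * A * (W * Wᴴ)).trace := by
        rw [hU', Matrix.mul_one, Matrix.trace_mul_comm, Matrix.mul_assoc]
    _ = (Aᴴ * A).trace := by rw [hW', Matrix.mul_one]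

lemma frobNorm_le_frobNorm {m n : ℕ} {A B : Matrix (Fin m) (Fin n) ℂ}
    (h : ∀ i j, ‖A i j‖ ≤ ‖B i j‖) : frobNorm A ≤ frobNorm B :=
  Real.sqrt_le_sqrt <| Finset.sum_le_sum fun i _ => Finset.sum_le_sum fun j _ =>
    pow_le_pow_left₀ (norm_nonneg _) (h i j) 2

/-- Clipping at one is a nearest-point map from the nonnegative reals to the complex unit disc. -/
lemma norm_sub_min_one_le {s : ℝ} {q : ℂ} (hs : 0 ≤ s) (hq : ‖q‖ ≤ 1) :
    ‖(s : ℂ) - ((min 1 s : ℝ) : ℂ)‖ ≤ ‖(s : ℂ) - q‖ := by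
  rw [← Complex.ofReal_sub, Complex.norm_real, Real.norm_eq_abs,
    abs_of_nonneg (sub_nonneg.2 (min_le_right _ _))]
  rcases le_total s 1 with h | h
  · simp [min_eq_right h]
  · rw [min_eq_left h]
    have := norm_sub_norm_le (s : ℂ) q
    rw [Complex.norm_real, Real.norm_eq_abs, abs_of_nonneg hs] at this
    linarith

/-- Correctness of the singular-value-thresholding projection onto the
spectral-norm unit ball: clipping the singular values of X = U Σ Vᴴ at 1
yields a matrix X̃ with ‖X̃‖₂ ≤ 1 that is a Frobenius-norm projection of X
onto {P : ‖P‖₂ ≤ 1}. -/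
theorem svd_thresholding_projection (m r : ℕ) (hr : 0 < r) (hmr : r ≤ m)
    (X : Matrix (Fin m) (Fin r) ℂ)
    (U : Matrix (Fin m) (Fin m) ℂ) (V : Matrix (Fin r) (Fin r) ℂ)
    (hU : U ∈ Matrix.unitaryGroup (Fin m) ℂ) (hV : V ∈ Matrix.unitaryGroup (Fin r) ℂ)
    (σ : Fin r → ℝ) (hσ : ∀ i, 0 ≤ σ i)
    (hX : X = U * (Matrix.of fun (i : Fin m) (j : Fin r) =>
      if (i : ℕ) = (j : ℕ) then ((σ j : ℝ) : ℂ) else 0) * Vᴴ) :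
    specNorm (U * (Matrix.of fun (i : Fin m) (j : Fin r) =>
        if (i : ℕ) = (j : ℕ) then ((min 1 (σ j) : ℝ) : ℂ) else 0) * Vᴴ) ≤ 1 ∧
      ∀ P : Matrix (Fin m) (Fin r) ℂ, specNorm P ≤ 1 →
        frobNorm (X - U * (Matrix.of fun (i : Fin m) (j : Fin r) =>
          if (i : ℕ) = (j : ℕ) then ((min 1 (σ j) : ℝ) : ℂ) else 0) * Vᴴ)
          ≤ frobNorm (X - P) := by
  have hVc := conjTranspose_mem_unitaryGroup hV
  have hUc := conjTranspose_mem_unitaryGroup hU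
  refine ⟨specNorm_mul_le_one (specNorm_mul_le_one (specNorm_le_one_of_mem_unitaryGroup hU)
    (specNorm_rectDiagonal_le_one hmr fun j => ?_)) (specNorm_le_one_of_mem_unitaryGroup hVc),
    fun P hP => ?_⟩
  · rw [Complex.norm_real, Real.norm_eq_abs, abs_of_nonneg (le_min zero_le_one (hσ j))]
    exact min_le_left _ _
  · have hQ : specNorm (Uᴴ * P * V) ≤ 1 :=
      specNorm_mul_le_one (specNorm_mul_le_one (specNorm_le_one_of_mem_unitaryGroup hUc) hP)
        (specNorm_le_one_of_mem_unitaryGroup hV)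
    have hPQ : P = U * (Uᴴ * P * V) * Vᴴ := by
      have hU' : U * Uᴴ = 1 := Matrix.mem_unitaryGroup_iff.1 hU
      have hV' : V * Vᴴ = 1 := Matrix.mem_unitaryGroup_iff.1 hV
      rw [Matrix.mul_assoc, Matrix.mul_assoc _ V, hV', Matrix.mul_one, ← Matrix.mul_assoc, hU',
        Matrix.one_mul]
    generalize Uᴴ * P * V = Q at hQ hPQ
    rw [hX, hPQ, ← Matrix.sub_mul, ← Matrix.mul_sub, ← Matrix.sub_mul, ← Matrix.mul_sub,
      frobNorm_unitary_mul_mul_unitary hU hVc, frobNorm_unitary_mul_mul_unitary hU hVc]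
    refine frobNorm_le_frobNorm fun i j => ?_
    simp only [Matrix.sub_apply, Matrix.of_apply]
    split_ifs
    · exact norm_sub_min_one_le (hσ j) ((norm_entry_le_specNorm Q i j).trans hQ)
    · simp
end
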